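/- arXiv:1102.2593 — 2 statements merged into one kernel-verified Lean document; each statement's English description precedes it below -/
import Mathlib

section
/- Let q be a prime power, let n, k, δ be integers with 1 < k ≤ n−k and 1 ≤ δ ≤ k−1, let C^MRD be an (n,k,δ)_q lifted MRD code, let H be its point–block incidence matrix over 𝔽_2, and let C^T be the binary linear code of length |C^MRD| = q^{(n−k)(k−δ+1)} with parity-check matrix Hᵀ (the null space of Hᵀ over 𝔽_2). Then every nonzero codeword of C^T has Hamming weight at least (q^k−1)/(q^{k−δ}−1) + 1; i.e., the minimum distance d^T of C^T satisfies d^T ≥ (q^k−1)/(q^{k−δ}−1) + 1. -/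
open Module Polynomial Matrix

variable (F : Type) [Field F] [Fintype F]

/-- `C` is a `[k × (n-k), (n-k)(k-δ+1), δ]_q` MRD (maximum rank distance) code:
an `F`-linear subspace of `k × (n-k)` matrices of dimension `(n-k)(k-δ+1)` in which
every nonzero matrix has rank at least `δ`. -/
def IsMRD (n k δ : ℕ) (C : Submodule F (Matrix (Fin k) (Fin (n - k)) F)) : Prop :=
  Module.finrank F C = (n - k) * (k - δ + 1) ∧
    ∀ A : Matrix (Fin k) (Fin (n - k)) F, A ∈ C → A ≠ 0 → δ ≤ A.rank

/-- The matrix `[I_k | A]`. -/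
def liftMatrix (n k : ℕ) (A : Matrix (Fin k) (Fin (n - k)) F) : Matrix (Fin k) (Fin n) F :=
  Matrix.of fun i j =>
    if h : (j : ℕ) < k then (if (i : ℕ) = (j : ℕ) then 1 else 0)
    else A i ⟨(j : ℕ) - k, by have := j.isLt; omega⟩

/-- The lifting of the matrix `A`: the row space of `[I_k | A]`, a subspace of `F^n`. -/
def liftSubspace (n k : ℕ) (A : Matrix (Fin k) (Fin (n - k)) F) : Submodule F (Fin n → F) :=
  Submodule.span F (Set.range fun i => liftMatrix F n k A i)

/-- The lifted code of a rank-metric code `C`: the set of liftings of all codewords of `C`. -/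
def liftedCode (n k : ℕ) (C : Submodule F (Matrix (Fin k) (Fin (n - k)) F)) :
    Set (Submodule F (Fin n → F)) :=
  {X | ∃ A ∈ C, X = liftSubspace F n k A}

/-- The subspace distance `d_S(X,Y) = dim X + dim Y - 2 dim (X ⊓ Y)`. -/
noncomputable def subDist {n : ℕ} (X Y : Submodule F (Fin n → F)) : ℕ :=
  finrank F X + finrank F Y - 2 * finrank F (X ⊓ Y : Submodule F (Fin n → F))

/-- `L^{(n,k)}`: vectors of `F^n` whose first `k` coordinates are not all zero. -/
def Lset (n k : ℕ) : Set (Fin n → F) := {v | ∃ i : Fin n, (i : ℕ) < k ∧ v i ≠ 0}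

/-- `V^n`: one-dimensional subspaces of `F^n` spanned by vectors of `L^{(n,k)}`. -/
def Vset (n k : ℕ) : Set (Submodule F (Fin n → F)) :=
  {X | ∃ v ∈ Lset F n k, X = Submodule.span F {v}}

/-- Projection of a vector of `F^n` onto its first `k` coordinates. -/
def projK (n k : ℕ) (v : Fin n → F) : Fin k → F :=
  fun i => if h : (i : ℕ) < n then v ⟨(i : ℕ), h⟩ else 0

/-- `V_A^{(n,k)}`: one-dimensional subspaces of `F^n` spanned by vectors whose projection
onto the first `k` coordinates is a nonzero vector spanning `A`. -/
def VA (n k : ℕ) (A : Submodule F (Fin k → F)) : Set (Submodule F (Fin n → F)) :=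
  {X | ∃ v : Fin n → F, projK F n k v ≠ 0 ∧ Submodule.span F {projK F n k v} = A ∧
    X = Submodule.span F {v}}

/-- `A_q(n,d,k)`: the maximum size of an `(n, M, d, k)_q` constant dimension code, i.e. of a
set of `k`-dimensional subspaces of `F^n` whose pairwise subspace distances are at least `d`. -/
noncomputable def Aq (n d k : ℕ) : ℕ :=
  sSup {M | ∃ S : Set (Submodule F (Fin n → F)), S.Finite ∧ S.ncard = M ∧
    (∀ X ∈ S, finrank F X = k) ∧ ∀ X ∈ S, ∀ Y ∈ S, X ≠ Y → d ≤ subDist F X Y}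

/-- The Gaussian coefficient `[n, k]_q`: the number of `k`-dimensional subspaces of `F^n`. -/
noncomputable def gaussNat (n k : ℕ) : ℕ :=
  Nat.card {X : Submodule F (Fin n → F) // finrank F X = k}

noncomputable instance (n k : ℕ) : Fintype {P : Submodule F (Fin n → F) // P ∈ Vset F n k} :=
  Fintype.ofFinite _

noncomputable instance (n k : ℕ) (C : Submodule F (Matrix (Fin k) (Fin (n - k)) F)) :
    Fintype {X : Submodule F (Fin n → F) // X ∈ liftedCode F n k C} :=
  Fintype.ofFinite _

noncomputable instance (n k : ℕ) : DecidableEq {P : Submodule F (Fin n → F) // P ∈ Vset F n k} :=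
  Classical.decEq _

open scoped Classical in
/-- The point–block incidence matrix `H` of a lifted MRD code: rows are indexed by the codewords
`X` of the lifted code, columns by the points `P ∈ V^n`, and `H_{X,P} = 1` iff `P ⊆ X`;
entries taken in a commutative ring `R`. -/
noncomputable def incidence (R : Type) [CommRing R] (n k : ℕ)
    (C : Submodule F (Matrix (Fin k) (Fin (n - k)) F)) :
    Matrix {X : Submodule F (Fin n → F) // X ∈ liftedCode F n k C}
           {P : Submodule F (Fin n → F) // P ∈ Vset F n k} R :=
  Matrix.of fun X P =>
    if (P : Submodule F (Fin n → F)) ≤ (X : Submodule F (Fin n → F)) then 1 else 0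

section LiftSubspace

variable {K : Type} [Field K] {n k : ℕ}

theorem mem_liftSubspace {A : Matrix (Fin k) (Fin (n - k)) K} {v : Fin n → K} :
    v ∈ liftSubspace K n k A ↔ ∃ c : Fin k → K, c ᵥ* liftMatrix K n k A = v := by
  simp only [liftSubspace, Submodule.mem_span_range_iff_exists_fun, Matrix.vecMul_eq_sum]

theorem vecMul_liftMatrix_castLE (hkn : k ≤ n) (A : Matrix (Fin k) (Fin (n - k)) K)
    (c : Fin k → K) (i : Fin k) : (c ᵥ* liftMatrix K n k A) (Fin.castLE hkn i) = c i := by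
  simp [Matrix.vecMul, dotProduct, liftMatrix, ← Fin.ext_iff]

theorem vecMul_liftMatrix_add (A : Matrix (Fin k) (Fin (n - k)) K)
    (c : Fin k → K) (j : Fin (n - k)) :
    (c ᵥ* liftMatrix K n k A) ⟨j + k, by omega⟩ = (c ᵥ* A) j := by
  simp [Matrix.vecMul, dotProduct, liftMatrix]

/-- A vector `(c, c A)` of the lifting of `A` lies in the lifting of `B` only if `c A = c B`. -/
theorem vecMul_eq_of_mem_liftSubspace (hkn : k ≤ n)
    {A B : Matrix (Fin k) (Fin (n - k)) K} {c : Fin k → K}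
    (h : c ᵥ* liftMatrix K n k A ∈ liftSubspace K n k B) : c ᵥ* A = c ᵥ* B := by
  obtain ⟨d, hd⟩ := mem_liftSubspace.1 h
  have hdc : d = c := by
    ext i
    rw [← vecMul_liftMatrix_castLE hkn B d i, hd, vecMul_liftMatrix_castLE]
  subst hdc
  ext j
  rw [← vecMul_liftMatrix_add, ← hd, vecMul_liftMatrix_add]

theorem span_vecMul_liftMatrix_mem_Vset (hkn : k ≤ n)
    (A : Matrix (Fin k) (Fin (n - k)) K) {c : Fin k → K} (hc : c ≠ 0) :
    Submodule.span K {c ᵥ* liftMatrix K n k A} ∈ Vset K n k := by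
  obtain ⟨i, hi⟩ := Function.ne_iff.1 hc
  exact ⟨_, ⟨Fin.castLE hkn i, i.isLt, by rwa [vecMul_liftMatrix_castLE]⟩, rfl⟩

end LiftSubspace

variable {F}

/-- A matrix with `k` rows and rank at least `δ` has at most `q ^ (k - δ) - 1` nonzero vectors in
its left kernel. -/
theorem card_left_kernel_ne_zero_le [DecidableEq F] {k m δ : ℕ} {A : Matrix (Fin k) (Fin m) F}
    (hA : δ ≤ A.rank) :
    (Finset.univ.filter fun c : Fin k → F => c ≠ 0 ∧ c ᵥ* A = 0).card ≤
      Fintype.card F ^ (k - δ) - 1 := by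
  classical
  have hker : finrank F (LinearMap.ker Aᵀ.mulVecLin) ≤ k - δ := by
    have h := LinearMap.finrank_range_add_finrank_ker Aᵀ.mulVecLin
    rw [← Matrix.rank, Matrix.rank_transpose, Module.finrank_fin_fun] at h
    omega
  have hcard : (Finset.univ.filter fun c : Fin k → F => c ᵥ* A = 0).card =
      Fintype.card F ^ finrank F (LinearMap.ker Aᵀ.mulVecLin) := by
    rw [← Module.card_eq_pow_finrank (K := F) (V := LinearMap.ker Aᵀ.mulVecLin),
      Fintype.card_subtype]
    simp
  have herase : (Finset.univ.filter fun c : Fin k → F => c ≠ 0 ∧ c ᵥ* A = 0) =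
      (Finset.univ.filter fun c : Fin k → F => c ᵥ* A = 0).erase 0 := by
    ext c; simp
  rw [herase, Finset.card_erase_of_mem (by simp), hcard]
  exact Nat.sub_le_sub_right (Nat.pow_le_pow_right Fintype.card_pos hker) 1

/-- If `X` is in the support of a codeword and `P ⊆ X` is a point, then another block of the
support contains `P`. -/
theorem exists_ne_of_incidence_mulVec_eq_zero {R : Type} [CommRing R] {n k : ℕ}
    {C : Submodule F (Matrix (Fin k) (Fin (n - k)) F)}
    {y : {X : Submodule F (Fin n → F) // X ∈ liftedCode F n k C} → R}
    (hy : (incidence F R n k C)ᵀ.mulVec y = 0)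
    {X : {X : Submodule F (Fin n → F) // X ∈ liftedCode F n k C}} (hX : y X ≠ 0)
    {P : Submodule F (Fin n → F)} (hP : P ∈ Vset F n k) (hPX : P ≤ X) :
    ∃ Y, Y ≠ X ∧ y Y ≠ 0 ∧ P ≤ Y := by
  by_contra! h
  have hsum := congrFun hy ⟨P, hP⟩
  simp only [Matrix.mulVec, dotProduct, incidence, Matrix.transpose_apply, Matrix.of_apply,
    ite_mul, one_mul, zero_mul, Pi.zero_apply] at hsum
  rw [Finset.sum_eq_single X (fun Y _ hYX => by
    by_cases hYy : y Y = 0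
    · simp [hYy]
    · simp [h Y hYX hYy]) (by simp), if_pos hPX] at hsum
  exact hX hsum

variable (F)

/-- Every nonzero codeword `y` of the binary code with parity-check matrix
`Hᵀ` (for `H` the incidence matrix of an `(n,k,δ)_q` lifted MRD code) has Hamming weight at
least `(q^k - 1)/(q^{k-δ} - 1) + 1`. -/
theorem stmt18 (q n k δ : ℕ) (hq : Fintype.card F = q)
    (hk : 1 < k) (hkn : k ≤ n - k) (hδ1 : 1 ≤ δ) (hδk : δ ≤ k - 1)
    (C : Submodule F (Matrix (Fin k) (Fin (n - k)) F)) (hC : IsMRD F n k δ C)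
    (y : {X : Submodule F (Fin n → F) // X ∈ liftedCode F n k C} → ZMod 2)
    (hy : (incidence F (ZMod 2) n k C)ᵀ.mulVec y = 0) (hy0 : y ≠ 0) :
    ((q : ℚ) ^ k - 1) / ((q : ℚ) ^ (k - δ) - 1) + 1 ≤ ({i | y i ≠ 0}.ncard : ℚ) := by
  classical
  have hkn' : k ≤ n := by omega
  choose M hMC hM using fun X : {X // X ∈ liftedCode F n k C} => X.2
  obtain ⟨X, hX⟩ := Function.ne_iff.1 hy0
  set S := Finset.univ.filter fun Y => y Y ≠ 0 with hS
  have hXS : X ∈ S := by simpa [hS] using hX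
  have hcover : (Finset.univ.erase (0 : Fin k → F)) ⊆ (S.erase X).biUnion fun Y =>
      Finset.univ.filter fun c : Fin k → F => c ≠ 0 ∧ c ᵥ* (M Y - M X) = 0 := by
    intro c hc
    have hc0 : c ≠ 0 := by simpa using hc
    obtain ⟨Y, hYX, hYy, hPY⟩ := exists_ne_of_incidence_mulVec_eq_zero hy hX
      (span_vecMul_liftMatrix_mem_Vset hkn' (M X) hc0) (by
        rw [Submodule.span_singleton_le_iff_mem, hM X, mem_liftSubspace]
        exact ⟨c, rfl⟩)
    rw [Submodule.span_singleton_le_iff_mem, hM Y] at hPY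
    simp only [Finset.mem_biUnion, Finset.mem_erase, Finset.mem_filter, Finset.mem_univ, true_and]
    refine ⟨Y, ⟨hYX, by simpa [hS] using hYy⟩, hc0, ?_⟩
    rw [Matrix.vecMul_sub, vecMul_eq_of_mem_liftSubspace hkn' hPY, sub_self]
  have hcount : q ^ k - 1 ≤ (S.card - 1) * (q ^ (k - δ) - 1) := by
    have hcard := (Finset.card_le_card hcover).trans <|
      Finset.card_biUnion_le_card_mul _ _ (q ^ (k - δ) - 1) fun Y hY => by
        rw [← hq]
        refine card_left_kernel_ne_zero_le (hC.2 _ (C.sub_mem (hMC Y) (hMC X)) ?_)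
        intro h
        exact Finset.ne_of_mem_erase hY
          (Subtype.ext (by rw [hM Y, hM X, sub_eq_zero.1 h]))
    rwa [Finset.card_erase_of_mem hXS, Finset.card_erase_of_mem (Finset.mem_univ _),
      Finset.card_univ, Fintype.card_fun, Fintype.card_fin, hq] at hcard
  have hq1 : 1 < q := hq ▸ Fintype.one_lt_card
  have hpos : (0 : ℚ) < (q : ℚ) ^ (k - δ) - 1 :=
    sub_pos.2 (one_lt_pow₀ (by exact_mod_cast hq1) (by omega))
  have hncard : {Y | y Y ≠ 0}.ncard = S.card := by
    rw [← Set.ncard_coe_finset, hS]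
    simp
  have hScard : 1 ≤ S.card := Finset.card_pos.2 ⟨X, hXS⟩
  rw [hncard, ← le_sub_iff_add_le, div_le_iff₀ hpos]
  have hcountQ : ((q ^ k - 1 : ℕ) : ℚ) ≤ (((S.card - 1) * (q ^ (k - δ) - 1) : ℕ) : ℚ) := by
    exact_mod_cast hcount
  push_cast [Nat.cast_sub hScard, Nat.cast_sub (Nat.one_le_pow _ q (by omega))] at hcountQ
  exact hcountQ
end

section
/- Let q be a prime power, let n, k, δ be integers with 1 < k ≤ n−k and 1 ≤ δ ≤ k−1, let C^MRD be an (n,k,δ)_q lifted MRD code, let H be its point–block incidence matrix over 𝔽_2, let C be the null space of H over 𝔽_2 and C^T the null space of Hᵀ over 𝔽_2. Then dim(C) ≥ (q^k−1)/(q−1) − 1 and dim(C^T) ≥ q^{(n−k)(k−δ+1)} − ((q^k−1)/(q−1))·(q^{n−k}−1) − 1. Moreover, if q is odd and (q^k−1)/(q−1) is odd, then these hold with equality: dim(C) = (q^k−1)/(q−1) − 1 and dim(C^T) = q^{(n−k)(k−δ+1)} − ((q^k−1)/(q−1))·q^{n−k} + (q^k−1)/(q−1) − 1. -/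
open Module Polynomial Matrix

variable (F : Type) [Field F] [Fintype F]

section LinearAlgebra

lemma odd_card_fiber {K V W : Type*} [Field K] [Fintype K] [AddCommGroup V] [Module K V]
    [Fintype V] [AddCommGroup W] [Module K W] [DecidableEq W] (hK : Odd (Fintype.card K))
    (f : V →ₗ[K] W) (hf : Function.Surjective f) (w : W) :
    ((Finset.univ.filter fun x => f x = w).card : ZMod 2) = 1 := by
  have h1 : (Finset.univ.filter fun x => f x = w).card =
      (Finset.univ.filter fun x => f x = 0).card :=
    AddMonoidHom.card_fiber_eq_of_mem_range f.toAddMonoidHom (hf w) (hf 0)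
  have h2 : (Finset.univ.filter fun x => f x = 0).card = Nat.card (LinearMap.ker f) := by
    rw [← Fintype.card_subtype, ← Nat.card_eq_fintype_card]
    rfl
  rw [h1, h2, Module.natCard_eq_pow_finrank (K := K), Nat.card_eq_fintype_card]
  exact (ZMod.natCast_eq_one_iff_odd).2 hK.pow

variable {K : Type*} [Field K]

lemma finrank_ker_mulVecLin_add_rank {m n : Type*} [Fintype m] [Fintype n] (M : Matrix m n K) :
    finrank K (LinearMap.ker M.mulVecLin) + M.rank = Fintype.card n := by
  rw [add_comm, Matrix.rank, LinearMap.finrank_range_add_finrank_ker, Module.finrank_fintype_fun_eq_card]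

/-- Functions on `G × W` which depend only on the first coordinate, through a function on `G`
whose values sum to zero. -/
def sumZeroConst (K G W : Type*) [Field K] [Fintype G] : Submodule K (G × W → K) :=
  (LinearMap.ker (∑ g : G, LinearMap.proj g : (G → K) →ₗ[K] K)).map
    (LinearMap.funLeft K K Prod.fst)

lemma mem_sumZeroConst {G W : Type*} [Fintype G] (x : G × W → K) :
    x ∈ sumZeroConst K G W ↔ ∃ a : G → K, ∑ g, a g = 0 ∧ ∀ p, x p = a p.1 := by
  simp only [sumZeroConst, Submodule.mem_map, LinearMap.mem_ker, LinearMap.sum_apply,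
    LinearMap.proj_apply]
  refine exists_congr fun a => and_congr_right fun _ => ?_
  rw [funext_iff]
  exact forall_congr' fun p => eq_comm

lemma finrank_sumZeroConst {G W : Type*} [Fintype G] [Nonempty G] [Nonempty W] :
    finrank K (sumZeroConst K G W) + 1 = Fintype.card G := by
  classical
  have hinj : Function.Injective (LinearMap.funLeft K K (Prod.fst : G × W → G)) :=
    LinearMap.funLeft_injective_of_surjective _ _ _ Prod.fst_surjective
  have hsurj : Function.Surjective (∑ g : G, LinearMap.proj g : (G → K) →ₗ[K] K) := by
    intro c
    obtain ⟨g⟩ := ‹Nonempty G›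
    exact ⟨Pi.single g c, by simp [LinearMap.sum_apply]⟩
  have h := LinearMap.finrank_range_add_finrank_ker (∑ g : G, LinearMap.proj g : (G → K) →ₗ[K] K)
  rw [LinearMap.range_eq_top.2 hsurj, finrank_top, Module.finrank_self,
    Module.finrank_fintype_fun_eq_card] at h
  rw [sumZeroConst, ← (Submodule.equivMapOfInjective _ hinj _).finrank_eq]
  omega

end LinearAlgebra

section TransversalDesign

variable {B G W : Type*} [Fintype G] [Fintype W] [DecidableEq W]

/-- The incidence matrix of blocks each of which meets every group `{g} × W` exactly once, in the
point `(g, f b g)`. -/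
def transversalMatrix (R : Type*) [CommRing R] (f : B → G → W) : Matrix B (G × W) R :=
  Matrix.of fun b p => if f b p.1 = p.2 then 1 else 0

lemma sumZeroConst_le_ker {K : Type*} [Field K] (f : B → G → W) :
    sumZeroConst K G W ≤ LinearMap.ker (transversalMatrix K f).mulVecLin := by
  intro x hx
  obtain ⟨a, ha, hx⟩ := (mem_sumZeroConst x).1 hx
  rw [LinearMap.mem_ker]
  ext b
  simp [Matrix.mulVec, dotProduct, transversalMatrix, Fintype.sum_prod_type, hx, ha]

/-- If any two points from distinct groups, and any single point, lie on an odd number of blocks,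
and the groups have odd size, the binary null space is as small as possible. -/
lemma ker_transversalMatrix_eq [Fintype B] [DecidableEq G] (f : B → G → W)
    (hW : Odd (Fintype.card W))
    (h1 : ∀ g w, ((Finset.univ.filter fun b => f b g = w).card : ZMod 2) = 1)
    (h2 : ∀ g g' w w', g ≠ g' →
      ((Finset.univ.filter fun b => f b g = w ∧ f b g' = w').card : ZMod 2) = 1) :
    LinearMap.ker (transversalMatrix (ZMod 2) f).mulVecLin = sumZeroConst (ZMod 2) G W := by
  refine le_antisymm (fun x hx => ?_) (sumZeroConst_le_ker f)
  have hx0 : ∀ b, ∑ g, x (g, f b g) = 0 := by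
    intro b
    have := congrFun (LinearMap.mem_ker.1 hx) b
    simpa [Matrix.mulVec, dotProduct, transversalMatrix, Fintype.sum_prod_type] using this
  have key : ∀ g w, x (g, w) + ∑ g' ∈ Finset.univ.erase g, ∑ w', x (g', w') = 0 := by
    intro g w
    have h : ∑ b ∈ Finset.univ.filter (fun b => f b g = w), ∑ g', x (g', f b g') = 0 :=
      Finset.sum_eq_zero fun b _ => hx0 b
    rw [Finset.sum_comm, ← Finset.add_sum_erase _ _ (Finset.mem_univ g)] at h
    rw [← h]
    congr 1
    · rw [Finset.sum_congr rfl (g := fun _ => x (g, w))]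
      · rw [Finset.sum_const, nsmul_eq_mul, h1, one_mul]
      · intro b hb
        rw [(Finset.mem_filter.1 hb).2]
    · refine Finset.sum_congr rfl fun g' hg' => ?_
      rw [← Finset.sum_fiberwise _ (fun b => f b g')]
      refine Finset.sum_congr rfl fun w' _ => ?_
      rw [Finset.filter_filter, Finset.sum_congr rfl (g := fun _ => x (g', w'))]
      · rw [Finset.sum_const, nsmul_eq_mul, h2 _ _ _ _ (Finset.ne_of_mem_erase hg').symm, one_mul]
      · intro b hb
        rw [(Finset.mem_filter.1 hb).2.2]
  rw [mem_sumZeroConst]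
  refine ⟨fun g => ∑ g' ∈ Finset.univ.erase g, ∑ w', x (g', w'), ?_, fun p => ?_⟩
  · have hsum : ∀ g, ∑ w, x (g, w) = ∑ g' ∈ Finset.univ.erase g, ∑ w', x (g', w') := by
      intro g
      rw [Finset.sum_congr rfl fun w _ => CharTwo.add_eq_zero.1 (key g w), Finset.sum_const,
        nsmul_eq_mul, Finset.card_univ, ZMod.natCast_eq_one_iff_odd.2 hW, one_mul]
    rcases isEmpty_or_nonempty G with hG | ⟨⟨g⟩⟩
    · simp
    · rw [← Finset.sum_congr rfl fun g _ => hsum g,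
        ← Finset.add_sum_erase _ _ (Finset.mem_univ g), hsum g, CharTwo.add_self_eq_zero]
  · exact CharTwo.add_eq_zero.1 (key p.1 p.2)

end TransversalDesign

section AppendVec

variable {α : Type*} {n k : ℕ}

/-- The concatenation of a vector of length `k` and a vector of length `n - k`. -/
def appendVec (u : Fin k → α) (v : Fin (n - k) → α) : Fin n → α := fun j =>
  if h : (j : ℕ) < k then u ⟨j, h⟩ else v ⟨(j : ℕ) - k, by have := j.isLt; omega⟩

lemma appendVec_inj (hkn : k ≤ n) {u u' : Fin k → α} {v v' : Fin (n - k) → α} :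
    appendVec u v = appendVec u' v' ↔ u = u' ∧ v = v' := by
  refine ⟨fun h => ⟨funext fun i => ?_, funext fun i => ?_⟩, fun h => by rw [h.1, h.2]⟩
  · simpa [appendVec] using congrFun h ⟨i, by omega⟩
  · simpa [appendVec] using congrFun h ⟨i + k, by omega⟩

lemma exists_eq_appendVec (hkn : k ≤ n) (w : Fin n → α) :
    ∃ (u : Fin k → α) (v : Fin (n - k) → α), w = appendVec u v := by
  refine ⟨fun i => w ⟨i, by omega⟩, fun i => w ⟨i + k, by omega⟩, funext fun j => ?_⟩
  by_cases h : (j : ℕ) < k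
  · simp [appendVec, h]
  · simp only [appendVec, h, dite_false]
    exact congrArg w (Fin.ext (by simp only; omega))

end AppendVec

section LiftedCode

variable {E : Type} [Field E] {n k δ : ℕ}

lemma smul_appendVec (a : E) (u : Fin k → E) (v : Fin (n - k) → E) :
    a • appendVec u v = appendVec (a • u) (a • v) := by
  ext j
  simp only [appendVec, Pi.smul_apply]
  split_ifs <;> rfl

lemma appendVec_mem_Lset (hkn : k ≤ n) (u : Fin k → E) (v : Fin (n - k) → E) :
    appendVec u v ∈ Lset E n k ↔ u ≠ 0 := by
  rw [Function.ne_iff]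
  constructor
  · rintro ⟨i, hi, h⟩
    exact ⟨⟨i, hi⟩, by simpa [appendVec, hi] using h⟩
  · rintro ⟨i, h⟩
    exact ⟨⟨i, by omega⟩, i.2, by simpa [appendVec] using h⟩

lemma vecMul_liftMatrix (A : Matrix (Fin k) (Fin (n - k)) E) (u : Fin k → E) :
    u ᵥ* liftMatrix E n k A = appendVec u (u ᵥ* A) := by
  ext j
  by_cases h : (j : ℕ) < k
  · have h' : ∀ i : Fin k, (i : ℕ) = j ↔ i = ⟨j, h⟩ := fun i => by rw [Fin.ext_iff]
    simp [Matrix.vecMul, dotProduct, liftMatrix, appendVec, h, h']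
  · simp [Matrix.vecMul, dotProduct, liftMatrix, appendVec, h]

lemma rank_add_le_of_vecMul_eq_zero {d m : ℕ} {A : Matrix (Fin k) (Fin m) E}
    {b : Fin d → Fin k → E} (hb : LinearIndependent E b) (h : ∀ i, b i ᵥ* A = 0) :
    A.rank + d ≤ k := by
  have h1 := finrank_ker_mulVecLin_add_rank Aᵀ
  have h2 : Submodule.span E (Set.range b) ≤ LinearMap.ker Aᵀ.mulVecLin := by
    rw [Submodule.span_le]
    rintro _ ⟨i, rfl⟩
    simp [h]
  have h3 := Submodule.finrank_mono h2
  rw [finrank_span_eq_card hb, Fintype.card_fin] at h3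
  rw [Matrix.rank_transpose, Fintype.card_fin] at h1
  omega

lemma appendVec_mem_liftSubspace (hkn : k ≤ n) (A : Matrix (Fin k) (Fin (n - k)) E)
    (u : Fin k → E) (v : Fin (n - k) → E) :
    appendVec u v ∈ liftSubspace E n k A ↔ u ᵥ* A = v := by
  have h : liftSubspace E n k A = LinearMap.range (liftMatrix E n k A).vecMulLinear :=
    (range_vecMulLinear _).symm
  simp only [h, LinearMap.mem_range, Matrix.vecMulLinear_apply, vecMul_liftMatrix,
    appendVec_inj hkn]
  constructor
  · rintro ⟨_, rfl, h⟩
    exact h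
  · exact fun h => ⟨u, rfl, h⟩

lemma liftSubspace_injective (hkn : k ≤ n) : Function.Injective (liftSubspace E n k) := by
  intro A B h
  refine Matrix.ext_of_single_vecMul fun i => ?_
  have := (appendVec_mem_liftSubspace hkn A (Pi.single i 1) _).2 rfl
  rw [h, appendVec_mem_liftSubspace hkn] at this
  exact this.symm

open scoped LinearAlgebra.Projectivization

lemma span_appendVec_rep_bijective (hkn : k ≤ n) : Function.Bijective
    (fun p : ℙ E (Fin k → E) × (Fin (n - k) → E) =>
      (⟨Submodule.span E {appendVec p.1.rep p.2}, _,
        (appendVec_mem_Lset hkn _ _).2 p.1.rep_nonzero, rfl⟩ :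
        {P : Submodule E (Fin n → E) // P ∈ Vset E n k})) := by
  constructor
  · rintro ⟨c, v⟩ ⟨c', v'⟩ h
    obtain ⟨a, ha⟩ := Submodule.span_singleton_eq_span_singleton.1 (Subtype.mk.inj h)
    simp only [Units.smul_def] at ha
    rw [smul_appendVec, appendVec_inj hkn] at ha
    have hc : c = c' := by
      rw [← c.mk_rep, ← c'.mk_rep, Projectivization.mk_eq_mk_iff]
      exact ⟨a⁻¹, by rw [← ha.1, Units.smul_def, smul_smul]; simp⟩
    subst hc
    have ha1 : (a : E) = 1 :=
      smul_left_injective E c.rep_nonzero (by simpa using ha.1)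
    rw [Prod.mk.injEq]
    exact ⟨rfl, by simpa [ha1] using ha.2⟩
  · rintro ⟨P, w, hw, rfl⟩
    obtain ⟨u, v, rfl⟩ := exists_eq_appendVec hkn w
    have hu := (appendVec_mem_Lset hkn u v).1 hw
    obtain ⟨a, ha⟩ := Projectivization.exists_smul_eq_mk_rep E u hu
    refine ⟨⟨Projectivization.mk E u hu, (a : E) • v⟩, Subtype.ext ?_⟩
    simp only
    rw [← ha, Units.smul_def, ← smul_appendVec]
    exact Submodule.span_singleton_smul_eq a.isUnit _

/-- Points of `V^n`, coordinatised by a point of the projective space and a tail vector. -/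
noncomputable def pointEquiv (hkn : k ≤ n) : ℙ E (Fin k → E) × (Fin (n - k) → E) ≃
    {P : Submodule E (Fin n → E) // P ∈ Vset E n k} :=
  Equiv.ofBijective _ (span_appendVec_rep_bijective hkn)

/-- Codewords of the lifted code correspond to codewords of the code. -/
noncomputable def blockEquiv (hkn : k ≤ n) (C : Submodule E (Matrix (Fin k) (Fin (n - k)) E)) :
    C ≃ {X : Submodule E (Fin n → E) // X ∈ liftedCode E n k C} :=
  Equiv.ofBijective (fun A => ⟨liftSubspace E n k A, A, A.2, rfl⟩)
    ⟨fun _ _ h => Subtype.ext (liftSubspace_injective hkn (Subtype.mk.inj h)),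
      fun ⟨_, A, hA, h⟩ => ⟨⟨A, hA⟩, Subtype.ext h.symm⟩⟩

open scoped Classical in
lemma incidence_submatrix (hkn : k ≤ n) (C : Submodule E (Matrix (Fin k) (Fin (n - k)) E))
    (R : Type) [CommRing R] :
    (incidence E R n k C).submatrix (blockEquiv hkn C) (pointEquiv hkn) =
      transversalMatrix R
        fun (A : C) (c : ℙ E (Fin k → E)) => c.rep ᵥ* (A : Matrix (Fin k) (Fin (n - k)) E) := by
  ext A p
  refine if_congr ?_ rfl rfl
  exact (Submodule.span_singleton_le_iff_mem _ _).trans (appendVec_mem_liftSubspace hkn _ _ _)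

/-- The map sending a codeword to its products with the vectors `b i`. -/
def evalRows (C : Submodule E (Matrix (Fin k) (Fin (n - k)) E)) {m : ℕ} (b : Fin m → Fin k → E) :
    C →ₗ[E] (Fin m → Fin (n - k) → E) where
  toFun A i := b i ᵥ* (A : Matrix (Fin k) (Fin (n - k)) E)
  map_add' A B := by ext; simp [Matrix.vecMul_add]
  map_smul' a A := by ext; simp [Matrix.vecMul_smul]

lemma evalRows_surjective (hδ1 : 1 ≤ δ) (hδk : δ ≤ k)
    {C : Submodule E (Matrix (Fin k) (Fin (n - k)) E)} (hC : IsMRD E n k δ C) {m : ℕ}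
    (hm : m ≤ k - δ + 1) (b : Fin m → Fin k → E) (hb : LinearIndependent E b) :
    Function.Surjective (evalRows C b) := by
  induction hm using Nat.decreasingInduction with
  | self =>
    refine (LinearMap.injective_iff_surjective_of_finrank_eq_finrank ?_).1 ?_
    · rw [hC.1, Module.finrank_pi_fintype]
      simp [mul_comm]
    · refine (injective_iff_map_eq_zero _).2 fun A hA => ?_
      by_contra h0
      have h1 := hC.2 A A.2 (by simpa using h0)
      have h2 := rank_add_le_of_vecMul_eq_zero hb fun i => congrFun hA i
      omega
  | of_succ m hm ih =>
    obtain ⟨x, hx⟩ := exists_linearIndependent_cons_of_lt_finrank hb (by simp; omega)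
    intro w
    obtain ⟨A, hA⟩ := ih _ hx (Fin.cons 0 w)
    exact ⟨A, funext fun i => by simpa [evalRows] using congrFun hA i.succ⟩

lemma ker_transversalMatrix_of_isMRD [Fintype E] [DecidableEq E] [Fintype (ℙ E (Fin k → E))]
    (hδ1 : 1 ≤ δ) (hδk : δ + 1 ≤ k) (hF : Odd (Fintype.card E))
    {C : Submodule E (Matrix (Fin k) (Fin (n - k)) E)} (hC : IsMRD E n k δ C) :
    LinearMap.ker (transversalMatrix (ZMod 2) fun (A : C) (c : ℙ E (Fin k → E)) =>
      c.rep ᵥ* (A : Matrix (Fin k) (Fin (n - k)) E)).mulVecLin =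
      sumZeroConst (ZMod 2) (ℙ E (Fin k → E)) (Fin (n - k) → E) := by
  classical
  have : Fintype C := Fintype.ofFinite _
  refine ker_transversalMatrix_eq _ (by simpa using hF.pow) (fun c v => ?_)
    (fun c c' v v' hc => ?_)
  · have hb : LinearIndependent E ![c.rep] := by
      simpa [linearIndependent_unique_iff] using c.rep_nonzero
    rw [← odd_card_fiber hF _ (evalRows_surjective hδ1 (by omega) hC (by omega) _ hb) ![v]]
    simp [evalRows, funext_iff (α := Fin 1)]
  · have hb : LinearIndependent E ![c.rep, c'.rep] := by
      have := (Projectivization.independent_iff).1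
        ((Projectivization.independent_pair_iff_ne c c').2 hc)
      rwa [show Projectivization.rep ∘ ![c, c'] = ![c.rep, c'.rep] by
        ext i : 1
        fin_cases i <;> rfl] at this
    rw [← odd_card_fiber hF _ (evalRows_surjective hδ1 (by omega) hC (by omega) _ hb) ![v, v']]
    simp [evalRows, funext_iff (α := Fin 2), Fin.forall_fin_two]

end LiftedCode


/-- Bounds on the dimensions of the binary codes `C` (null space of `H`) and
`Cᵀ` (null space of `Hᵀ`), for `H` the incidence matrix of an `(n,k,δ)_q` lifted MRD code:
`dim C ≥ (q^k-1)/(q-1) - 1` and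
`dim Cᵀ ≥ q^{(n-k)(k-δ+1)} - ((q^k-1)/(q-1))(q^{n-k}-1) - 1`,
with equality in both if `q` and `(q^k-1)/(q-1)` are odd. -/
theorem stmt19 (q n k δ : ℕ) (hq : Fintype.card F = q)
    (hk : 1 < k) (hkn : k ≤ n - k) (hδ1 : 1 ≤ δ) (hδk : δ ≤ k - 1)
    (C : Submodule F (Matrix (Fin k) (Fin (n - k)) F)) (hC : IsMRD F n k δ C) :
    (q ^ k - 1) / (q - 1) - 1 ≤
      finrank (ZMod 2) (LinearMap.ker (incidence F (ZMod 2) n k C).mulVecLin) ∧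
    (q : ℤ) ^ ((n - k) * (k - δ + 1)) -
        (((q ^ k - 1) / (q - 1) : ℕ) : ℤ) * ((q : ℤ) ^ (n - k) - 1) - 1 ≤
      (finrank (ZMod 2) (LinearMap.ker ((incidence F (ZMod 2) n k C)ᵀ.mulVecLin)) : ℤ) ∧
    (Odd q → Odd ((q ^ k - 1) / (q - 1)) →
      finrank (ZMod 2) (LinearMap.ker (incidence F (ZMod 2) n k C).mulVecLin) =
        (q ^ k - 1) / (q - 1) - 1 ∧
      (finrank (ZMod 2) (LinearMap.ker ((incidence F (ZMod 2) n k C)ᵀ.mulVecLin)) : ℤ) =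
        (q : ℤ) ^ ((n - k) * (k - δ + 1)) -
          (((q ^ k - 1) / (q - 1) : ℕ) : ℤ) * (q : ℤ) ^ (n - k) +
          (((q ^ k - 1) / (q - 1) : ℕ) : ℤ) - 1) := by
  classical
  have hkn' : k ≤ n := by omega
  have : Fintype (Projectivization F (Fin k → F)) := Fintype.ofFinite _
  have : Fintype C := Fintype.ofFinite _
  have : Nontrivial (Fin k → F) := by
    have : Nonempty (Fin k) := ⟨⟨0, by omega⟩⟩
    infer_instance
  set N := (q ^ k - 1) / (q - 1) with hN
  have hcardG : Fintype.card (Projectivization F (Fin k → F)) = N := by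
    rw [← Nat.card_eq_fintype_card, Projectivization.card'', Nat.card_eq_fintype_card,
      Nat.card_eq_fintype_card, hq]
    simp [hq, hN]
  set M := transversalMatrix (ZMod 2) fun (A : C) (c : Projectivization F (Fin k → F)) =>
    c.rep ᵥ* (A : Matrix (Fin k) (Fin (n - k)) F) with hM
  have hrank : (incidence F (ZMod 2) n k C).rank = M.rank := by
    rw [hM, ← incidence_submatrix hkn', Matrix.rank_submatrix]
  have hker := finrank_ker_mulVecLin_add_rank (incidence F (ZMod 2) n k C)
  have hkerT := finrank_ker_mulVecLin_add_rank (incidence F (ZMod 2) n k C)ᵀ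
  have hkerM := finrank_ker_mulVecLin_add_rank M
  have hcardM : Fintype.card (Projectivization F (Fin k → F) × (Fin (n - k) → F)) = N * q ^ (n - k) := by
    simp [hcardG, hq]
  rw [hrank, ← Fintype.card_congr (pointEquiv hkn'), hcardM] at hker
  rw [Matrix.rank_transpose, hrank, ← Fintype.card_congr (blockEquiv hkn' C),
    Module.card_eq_pow_finrank (K := F), hC.1, hq] at hkerT
  rw [hcardM] at hkerM
  have hK0 := finrank_sumZeroConst (K := ZMod 2) (G := Projectivization F (Fin k → F)) (W := Fin (n - k) → F)
  rw [hcardG] at hK0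
  have hle := Submodule.finrank_mono (sumZeroConst_le_ker (K := ZMod 2)
    fun (A : C) (c : Projectivization F (Fin k → F)) => c.rep ᵥ* (A : Matrix (Fin k) (Fin (n - k)) F))
  rw [← hM] at hle
  have hkerZ := congrArg (Nat.cast : ℕ → ℤ) hkerM
  have hkerTZ := congrArg (Nat.cast : ℕ → ℤ) hkerT
  push_cast at hkerZ hkerTZ
  refine ⟨by omega, ?_, fun hodd _ => ?_⟩
  · rw [mul_sub, mul_one, ← hkerTZ, ← hkerZ]
    omega
  · have heq := congrArg (fun S : Submodule (ZMod 2) _ => finrank (ZMod 2) S)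
      (ker_transversalMatrix_of_isMRD hδ1 (by omega) (hq ▸ hodd) hC)
    change finrank _ (LinearMap.ker M.mulVecLin) = finrank _ _ at heq
    refine ⟨by omega, ?_⟩
    rw [← hkerTZ, ← hkerZ]
    omega
end
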